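/- Let n ≥ 1, 1 < p < ∞, 0 < q < p−1, 0 < α < n/p, and let σ be a locally finite nonnegative Borel measure on ℝⁿ. Then there exists a point x ∈ ℝⁿ with K_{α,p,q}σ(x) < ∞ if and only if ∫_a^∞ ( κ(B(0,ρ))^{q(p−1)/(p−1−q)} / ρ^{n−αp} )^{1/(p−1)} dρ/ρ < ∞ for some (equivalently, for all) a > 0. -/

import Mathlib

open MeasureTheory Metric Set
open scoped ENNReal NNReal

/-- The Wolff potential `W_{α,p}ν(x) = ∫₀^∞ (ν(B(x,ρ))/ρ^{n−αp})^{1/(p−1)} dρ/ρ`. -/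
noncomputable def wolffPot (n : ℕ) (α p : ℝ)
    (ν : Measure (EuclideanSpace ℝ (Fin n))) (x : EuclideanSpace ℝ (Fin n)) : ℝ≥0∞ :=
  ∫⁻ ρ in Set.Ioi (0 : ℝ),
    (ν (Metric.ball x ρ) / ENNReal.ofReal (ρ ^ ((n : ℝ) - α * p))) ^ (1 / (p - 1)) /
      ENNReal.ofReal ρ

/-- The least constant `κ(E)` such that
`(∫_E (W_{α,p}ν)^q dσ)^{1/q} ≤ κ · ν(ℝⁿ)^{1/(p−1)}` for all finite measures `ν`. -/
noncomputable def embC (n : ℕ) (α p q : ℝ) (σ : Measure (EuclideanSpace ℝ (Fin n)))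
    (E : Set (EuclideanSpace ℝ (Fin n))) : ℝ≥0∞ :=
  sInf {κ : ℝ≥0∞ | ∀ ν : Measure (EuclideanSpace ℝ (Fin n)), IsFiniteMeasure ν →
    (∫⁻ y in E, wolffPot n α p ν y ^ q ∂σ) ^ (1 / q) ≤ κ * (ν Set.univ) ^ (1 / (p - 1))}

/-- The intrinsic potential of Wolff type
`K_{α,p,q}σ(x) = ∫₀^∞ (κ(B(x,ρ))^{q(p−1)/(p−1−q)}/ρ^{n−αp})^{1/(p−1)} dρ/ρ`. -/
noncomputable def intK (n : ℕ) (α p q : ℝ) (σ : Measure (EuclideanSpace ℝ (Fin n)))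
    (x : EuclideanSpace ℝ (Fin n)) : ℝ≥0∞ :=
  ∫⁻ ρ in Set.Ioi (0 : ℝ),
    (embC n α p q σ (Metric.ball x ρ) ^ (q * (p - 1) / (p - 1 - q)) /
      ENNReal.ofReal (ρ ^ ((n : ℝ) - α * p))) ^ (1 / (p - 1)) / ENNReal.ofReal ρ

section Embedding

variable {n : ℕ} {α p q : ℝ} {σ ν μ : Measure (EuclideanSpace ℝ (Fin n))}

lemma wolffPot_mono (hp : 1 < p) (h : ν ≤ μ) (x : EuclideanSpace ℝ (Fin n)) :
    wolffPot n α p ν x ≤ wolffPot n α p μ x := by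
  have hr : 0 ≤ 1 / (p - 1) := one_div_nonneg.2 (by linarith)
  refine lintegral_mono fun ρ => ?_
  gcongr

lemma wolffPot_smul (hp : 1 < p) {c : ℝ≥0∞} (hc : c ≠ ⊤) (x : EuclideanSpace ℝ (Fin n)) :
    wolffPot n α p (c • ν) x = c ^ (1 / (p - 1)) * wolffPot n α p ν x := by
  have hr : 0 ≤ 1 / (p - 1) := one_div_nonneg.2 (by linarith)
  rw [wolffPot, wolffPot, ← lintegral_const_mul' _ _ (ENNReal.rpow_ne_top_of_nonneg hr hc)]
  refine lintegral_congr fun ρ => ?_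
  rw [Measure.smul_apply, smul_eq_mul, mul_div_assoc, ENNReal.mul_rpow_of_nonneg _ _ hr,
    mul_div_assoc]

lemma wolffPot_zero (hp : 1 < p) (x : EuclideanSpace ℝ (Fin n)) :
    wolffPot n α p 0 x = 0 := by
  have hr : 0 < 1 / (p - 1) := one_div_pos.2 (by linarith)
  simp [wolffPot, ENNReal.zero_rpow_of_pos hr, -one_div]

lemma embC_mono (hq : 0 < q) {E F : Set (EuclideanSpace ℝ (Fin n))} (h : E ⊆ F) :
    embC n α p q σ E ≤ embC n α p q σ F := by
  refine sInf_le_sInf fun κ hκ ν hν => le_trans ?_ (hκ ν hν)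
  have : 0 ≤ 1 / q := by positivity
  gcongr

lemma lintegral_wolffPot_rpow_le (hp : 1 < p) (hq : 0 < q)
    (hν0 : ν univ ≠ 0) (hν : ν univ ≠ ⊤) (E : Set (EuclideanSpace ℝ (Fin n))) :
    ∫⁻ y in E, wolffPot n α p ν y ^ q ∂σ ≤
      embC n α p q σ E ^ q * (ν univ) ^ (q / (p - 1)) := by
  have hr : 0 ≤ 1 / (p - 1) := one_div_nonneg.2 (by linarith)
  have h0 : ν univ ^ (1 / (p - 1)) ≠ 0 := (ENNReal.rpow_pos (pos_iff_ne_zero.2 hν0) hν).ne'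
  have ht : ν univ ^ (1 / (p - 1)) ≠ ⊤ := ENNReal.rpow_ne_top_of_nonneg hr hν
  have key : (∫⁻ y in E, wolffPot n α p ν y ^ q ∂σ) ^ (1 / q) ≤
      embC n α p q σ E * ν univ ^ (1 / (p - 1)) := by
    rw [← ENNReal.div_le_iff h0 ht]
    refine le_sInf fun κ hκ => ?_
    rw [ENNReal.div_le_iff h0 ht]
    exact hκ ν ⟨hν.lt_top⟩
  have := ENNReal.rpow_le_rpow key hq.le
  rwa [ENNReal.mul_rpow_of_nonneg _ _ hq.le, ← ENNReal.rpow_mul, ← ENNReal.rpow_mul,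
    one_div_mul_cancel hq.ne', ENNReal.rpow_one, one_div_mul_eq_div] at this

lemma exists_measure_univ_eq_one_of_lt_embC (hp : 1 < p) (hq : 0 < q)
    {E : Set (EuclideanSpace ℝ (Fin n))} {b : ℝ≥0∞} (hb : b < embC n α p q σ E) :
    ∃ ν : Measure (EuclideanSpace ℝ (Fin n)), ν univ = 1 ∧
      b ^ q ≤ ∫⁻ y in E, wolffPot n α p ν y ^ q ∂σ := by
  have hr : 0 ≤ 1 / (p - 1) := one_div_nonneg.2 (by linarith)
  have hnot := notMem_of_lt_csInf' hb
  simp only [mem_ofPred_eq, not_forall, not_le] at hnot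
  obtain ⟨ν, hν, hlt⟩ := hnot
  have hν0 : ν univ ≠ 0 := by
    intro h
    rw [Measure.measure_univ_eq_zero] at h
    simp [h, wolffPot_zero hp, ENNReal.zero_rpow_of_pos hq, -one_div,
      ENNReal.zero_rpow_of_pos (one_div_pos.2 hq)] at hlt
  have hνt : ν univ ≠ ⊤ := measure_ne_top ν _
  have hi : (ν univ)⁻¹ ≠ ⊤ := ENNReal.inv_ne_top.2 hν0
  refine ⟨(ν univ)⁻¹ • ν, ?_, ?_⟩
  · rw [Measure.smul_apply, smul_eq_mul, ENNReal.inv_mul_cancel hν0 hνt]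
  · simp_rw [wolffPot_smul hp hi, ENNReal.mul_rpow_of_nonneg _ _ hq.le]
    rw [lintegral_const_mul' _ _ (ENNReal.rpow_ne_top_of_nonneg hq.le
      (ENNReal.rpow_ne_top_of_nonneg hr hi)), ENNReal.inv_rpow, ENNReal.inv_rpow, mul_comm,
      ← div_eq_mul_inv]
    have h1 : (ν univ ^ (1 / (p - 1))) ^ q ≠ 0 :=
      (ENNReal.rpow_pos (ENNReal.rpow_pos (pos_iff_ne_zero.2 hν0) hνt)
        (ENNReal.rpow_ne_top_of_nonneg hr hνt)).ne'
    have h2 : (ν univ ^ (1 / (p - 1))) ^ q ≠ ⊤ :=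
      ENNReal.rpow_ne_top_of_nonneg hq.le (ENNReal.rpow_ne_top_of_nonneg hr hνt)
    rw [ENNReal.le_div_iff_mul_le (.inl h1) (.inl h2), ← ENNReal.mul_rpow_of_nonneg _ _ hq.le]
    have := ENNReal.rpow_le_rpow hlt.le hq.le
    rwa [← ENNReal.rpow_mul, one_div_mul_cancel hq.ne', ENNReal.rpow_one] at this

lemma sum_rpow_le_of_witness {ι : Type*} (hp : 1 < p) (hq : 0 < q) (hqp : q < p - 1)
    {F : Set (EuclideanSpace ℝ (Fin n))} (t : Finset ι)
    {E : ι → Set (EuclideanSpace ℝ (Fin n))} (hE : ∀ i ∈ t, MeasurableSet (E i))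
    (hd : (t : Set ι).PairwiseDisjoint E) (hEF : ∀ i ∈ t, E i ⊆ F)
    {b : ι → ℝ≥0∞} (hb : ∀ i ∈ t, b i ≠ ⊤)
    {m : ι → Measure (EuclideanSpace ℝ (Fin n))} (hm : ∀ i ∈ t, m i univ = 1)
    (hbm : ∀ i ∈ t, b i ^ q ≤ ∫⁻ y in E i, wolffPot n α p (m i) y ^ q ∂σ) :
    ∑ i ∈ t, b i ^ (q * (p - 1) / (p - 1 - q)) ≤
      embC n α p q σ F ^ (q * (p - 1) / (p - 1 - q)) := by
  set s := q * (p - 1) / (p - 1 - q) with hs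
  have hp1 : 0 < p - 1 := by linarith
  have hd' : 0 < p - 1 - q := by linarith
  have hs0 : 0 < s := by positivity
  have hr : 0 ≤ 1 / (p - 1) := by positivity
  have hat : ∀ i ∈ t, b i ^ s ≠ ⊤ := fun i hi => ENNReal.rpow_ne_top_of_nonneg hs0.le (hb i hi)
  set S := ∑ i ∈ t, b i ^ s with hS
  have hSt : S ≠ ⊤ := ENNReal.sum_ne_top.2 hat
  rcases eq_or_ne S 0 with h0 | h0
  · rw [h0]; exact zero_le
  set ν := ∑ i ∈ t, (b i ^ s) • m i with hν
  have hνu : ν univ = S := by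
    rw [hν, hS, Measure.coe_finsetSum, Finset.sum_apply]
    refine Finset.sum_congr rfl fun i hi => ?_
    rw [Measure.smul_apply, hm i hi, smul_eq_mul, mul_one]
  have hle : ∀ i ∈ t, (b i ^ s) • m i ≤ ν := fun i hi =>
    Finset.single_le_sum (f := fun i => (b i ^ s) • m i) (fun _ _ => Measure.zero_le _) hi
  have hterm : ∀ i ∈ t, b i ^ s ≤ ∫⁻ y in E i, wolffPot n α p ν y ^ q ∂σ := by
    intro i hi
    calc b i ^ s = ((b i ^ s) ^ (1 / (p - 1))) ^ q * b i ^ q := by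
          rw [← ENNReal.rpow_mul, ← ENNReal.rpow_mul,
            ← ENNReal.rpow_add_of_nonneg _ _ (by positivity) hq.le]
          congr 1
          rw [hs]; field_simp; ring
      _ ≤ ((b i ^ s) ^ (1 / (p - 1))) ^ q * ∫⁻ y in E i, wolffPot n α p (m i) y ^ q ∂σ := by
          gcongr; exact hbm i hi
      _ = ∫⁻ y in E i, wolffPot n α p ((b i ^ s) • m i) y ^ q ∂σ := by
          simp_rw [wolffPot_smul hp (hat i hi), ENNReal.mul_rpow_of_nonneg _ _ hq.le]
          rw [lintegral_const_mul' _ _ (ENNReal.rpow_ne_top_of_nonneg hq.le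
            (ENNReal.rpow_ne_top_of_nonneg hr (hat i hi)))]
      _ ≤ _ := by
          gcongr with y
          exact wolffPot_mono hp (hle i hi) y
  have h1 : S ≤ embC n α p q σ F ^ q * S ^ (q / (p - 1)) := by
    calc S ≤ ∑ i ∈ t, ∫⁻ y in E i, wolffPot n α p ν y ^ q ∂σ := Finset.sum_le_sum hterm
      _ = ∫⁻ y in ⋃ i ∈ t, E i, wolffPot n α p ν y ^ q ∂σ :=
          (lintegral_biUnion_finset hd hE _).symm
      _ ≤ ∫⁻ y in F, wolffPot n α p ν y ^ q ∂σ := lintegral_mono_set (iUnion₂_subset hEF)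
      _ ≤ _ := by
          have := lintegral_wolffPot_rpow_le (α := α) (σ := σ) hp hq (ν := ν)
            (by rwa [hνu]) (by rwa [hνu]) F
          rwa [hνu] at this
  have h2 : S ^ (1 - q / (p - 1)) ≤ embC n α p q σ F ^ q := by
    rw [ENNReal.rpow_sub _ _ h0 hSt, ENNReal.rpow_one]
    exact ENNReal.div_le_of_le_mul h1
  have h3 := ENNReal.rpow_le_rpow h2 (z := (p - 1) / (p - 1 - q)) (by positivity)
  rw [← ENNReal.rpow_mul, ← ENNReal.rpow_mul] at h3
  have e1 : (1 - q / (p - 1)) * ((p - 1) / (p - 1 - q)) = 1 := by field_simp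
  have e2 : q * ((p - 1) / (p - 1 - q)) = s := by rw [hs]; ring
  rwa [e1, e2, ENNReal.rpow_one] at h3

/-- The set function `κ(·)^{q(p-1)/(p-1-q)}` is superadditive. -/
lemma sum_embC_rpow_le {ι : Type*} (hp : 1 < p) (hq : 0 < q) (hqp : q < p - 1)
    {F : Set (EuclideanSpace ℝ (Fin n))} (hF : embC n α p q σ F ≠ ⊤) (t : Finset ι)
    {E : ι → Set (EuclideanSpace ℝ (Fin n))} (hE : ∀ i ∈ t, MeasurableSet (E i))
    (hd : (t : Set ι).PairwiseDisjoint E) (hEF : ∀ i ∈ t, E i ⊆ F) :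
    ∑ i ∈ t, embC n α p q σ (E i) ^ (q * (p - 1) / (p - 1 - q)) ≤
      embC n α p q σ F ^ (q * (p - 1) / (p - 1 - q)) := by
  have hd' : 0 < p - 1 - q := by linarith
  have hp1 : 0 < p - 1 := by linarith
  have hs0 : 0 < q * (p - 1) / (p - 1 - q) := by positivity
  rw [← one_mul (∑ i ∈ t, _)]
  refine ENNReal.mul_le_of_forall_lt fun a ha B hB => ?_
  set c := a ^ (q * (p - 1) / (p - 1 - q))⁻¹ with hc
  have hc1 : c < 1 := ENNReal.rpow_lt_one ha (by positivity)
  have hca : a = c ^ (q * (p - 1) / (p - 1 - q)) := by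
    rw [hc, ENNReal.rpow_inv_rpow hs0.ne']
  have hfin : ∀ i ∈ t, embC n α p q σ (E i) ≠ ⊤ := fun i hi =>
    ((embC_mono hq (hEF i hi)).trans_lt hF.lt_top).ne
  have hw : ∀ i, i ∈ t → ∃ m : Measure (EuclideanSpace ℝ (Fin n)), m univ = 1 ∧
      (c * embC n α p q σ (E i)) ^ q ≤ ∫⁻ y in E i, wolffPot n α p m y ^ q ∂σ := by
    intro i hi
    rcases eq_or_ne (embC n α p q σ (E i)) 0 with h0 | h0
    · refine ⟨Measure.dirac 0, measure_univ, ?_⟩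
      rw [h0, mul_zero, ENNReal.zero_rpow_of_pos hq]
      exact zero_le
    · refine exists_measure_univ_eq_one_of_lt_embC hp hq ?_
      calc c * embC n α p q σ (E i) < 1 * embC n α p q σ (E i) :=
            ENNReal.mul_lt_mul_left h0 (hfin i hi) hc1
        _ = _ := one_mul _
  choose! m hm hbm using hw
  have := sum_rpow_le_of_witness hp hq hqp t hE hd hEF
    (fun i hi => ENNReal.mul_ne_top hc1.ne_top (hfin i hi)) hm hbm
  simp_rw [ENNReal.mul_rpow_of_nonneg _ _ hs0.le, ← Finset.mul_sum, ← hca] at this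
  exact (mul_le_mul_right hB.le a).trans this

end Embedding

section SetFunction

variable {n : ℕ} {Φ : Set (EuclideanSpace ℝ (Fin n)) → ℝ≥0∞}

lemma setLIntegral_Ioi_comp_mul_left {c : ℝ} (hc : 0 < c) (b : ℝ) (G : ℝ → ℝ≥0∞) :
    ∫⁻ ρ in Ioi (c * b), G ρ = ENNReal.ofReal c * ∫⁻ ρ in Ioi b, G (c * ρ) := by
  rw [← lintegral_const_mul' _ _ ENNReal.ofReal_ne_top, ← Set.image_mul_left_Ioi hc,
    lintegral_image_eq_lintegral_abs_deriv_mul (f' := fun _ => c) measurableSet_Ioi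
      (fun x _ => by simpa using ((hasDerivAt_id x).const_mul c).hasDerivWithinAt)
      (mul_right_injective₀ hc.ne').injOn, abs_of_pos hc]

/-- Tails of the potential at two centres are comparable. -/
lemma setLIntegral_tail_lt_top (hΦ : Monotone Φ) {γ r : ℝ} (hr : 0 < r)
    {a b : ℝ} (hb : 0 < b) {x y : EuclideanSpace ℝ (Fin n)}
    (h : ∫⁻ ρ in Ioi a, (Φ (ball y ρ) / ENNReal.ofReal (ρ ^ γ)) ^ r / ENNReal.ofReal ρ < ⊤) :
    ∫⁻ ρ in Ioi b, (Φ (ball x ρ) / ENNReal.ofReal (ρ ^ γ)) ^ r / ENNReal.ofReal ρ < ⊤ := by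
  obtain ⟨c, hc0, hcx, hca⟩ : ∃ c : ℝ, 0 < c ∧ 1 + dist x y / b ≤ c ∧ a ≤ c * b := by
    refine ⟨1 + dist x y / b + |a| / b, by positivity, by linarith [show 0 ≤ |a| / b by positivity],
      ?_⟩
    have : (1 + dist x y / b + |a| / b) * b = b + dist x y + |a| := by field_simp
    rw [this]
    linarith [le_abs_self a, dist_nonneg (x := x) (y := y)]
  have hcb := (lintegral_mono_set (Ioi_subset_Ioi hca)).trans_lt h
  rw [setLIntegral_Ioi_comp_mul_left hc0, ← lintegral_const_mul' _ _ ENNReal.ofReal_ne_top] at hcb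
  have hK : ENNReal.ofReal (c ^ γ) ^ r ≠ ⊤ :=
    ENNReal.rpow_ne_top_of_nonneg hr.le ENNReal.ofReal_ne_top
  refine lt_of_le_of_lt ?_ (ENNReal.mul_lt_top hK.lt_top hcb)
  rw [← lintegral_const_mul' _ _ hK]
  refine setLIntegral_mono' measurableSet_Ioi fun ρ hρ => ?_
  have hρb : b < ρ := hρ
  have hρ0 : 0 < ρ := hb.trans hρb
  have hsub : ball x ρ ⊆ ball y (c * ρ) := by
    refine ball_subset_ball' ?_
    calc ρ + dist x y ≤ ρ + dist x y / b * ρ := by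
          gcongr
          rw [div_mul_eq_mul_div, le_div_iff₀ hb]
          gcongr
      _ = (1 + dist x y / b) * ρ := by ring
      _ ≤ c * ρ := by gcongr
  have hcγ : 0 < c ^ γ := Real.rpow_pos_of_pos hc0 _
  have e1 : ENNReal.ofReal (c ^ γ) ≠ 0 := by simpa using hcγ
  have e2 : ENNReal.ofReal c ≠ 0 := by simpa using hc0
  calc (Φ (ball x ρ) / ENNReal.ofReal (ρ ^ γ)) ^ r / ENNReal.ofReal ρ
      ≤ (Φ (ball y (c * ρ)) / ENNReal.ofReal (ρ ^ γ)) ^ r / ENNReal.ofReal ρ := by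
        gcongr
        exact hΦ hsub
    _ = _ := by
        rw [Real.mul_rpow hc0.le hρ0.le, ENNReal.ofReal_mul hcγ.le, ENNReal.ofReal_mul hc0.le,
          ← mul_div_assoc (ENNReal.ofReal c), ENNReal.mul_div_mul_left _ _ e2 ENNReal.ofReal_ne_top,
          ← mul_div_assoc, ← ENNReal.mul_rpow_of_nonneg _ _ hr.le, ← mul_div_assoc,
          ENNReal.mul_div_mul_left _ _ e1 ENNReal.ofReal_ne_top]

lemma ne_top_of_setLIntegral_tail_lt_top (hΦ : Monotone Φ) {γ r : ℝ} (hr : 0 < r) {a : ℝ}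
    (h : ∫⁻ ρ in Ioi a, (Φ (ball 0 ρ) / ENNReal.ofReal (ρ ^ γ)) ^ r / ENNReal.ofReal ρ < ⊤)
    (R : ℝ) : Φ (ball 0 R) ≠ ⊤ := by
  intro hR
  refine h.ne (top_unique ?_)
  calc (⊤ : ℝ≥0∞) = ∫⁻ ρ in Ioi (max a R), ⊤ := by simp
    _ ≤ ∫⁻ ρ in Ioi (max a R), (Φ (ball 0 ρ) / ENNReal.ofReal (ρ ^ γ)) ^ r / ENNReal.ofReal ρ := by
        refine setLIntegral_mono' measurableSet_Ioi fun ρ hρ => ?_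
        have hρR : R ≤ ρ := (le_max_right _ _).trans (le_of_lt hρ)
        rw [top_unique (hR.ge.trans (hΦ (ball_subset_ball hρR))),
          ENNReal.top_div_of_ne_top ENNReal.ofReal_ne_top, ENNReal.top_rpow_of_pos hr,
          ENNReal.top_div_of_ne_top ENNReal.ofReal_ne_top]
    _ ≤ _ := lintegral_mono_set (Ioi_subset_Ioi (le_max_left _ _))

/-- Weak-type estimate for a superadditive set function at a fixed scale. -/
lemma volume_setOf_lt_le {R : Set (EuclideanSpace ℝ (Fin n))} {T : ℝ≥0∞}
    (hsup : ∀ (t : Finset (EuclideanSpace ℝ (Fin n))) (ρ : ℝ), (∀ x ∈ t, ball x ρ ⊆ R) →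
      (t : Set (EuclideanSpace ℝ (Fin n))).PairwiseDisjoint (fun x => ball x ρ) →
      ∑ x ∈ t, Φ (ball x ρ) ≤ T)
    {A : Set (EuclideanSpace ℝ (Fin n))} {ρ : ℝ} (hρ : 0 < ρ) (hA : ∀ x ∈ A, ball x ρ ⊆ R)
    {L : ℝ≥0∞} (hL0 : L ≠ 0) (hLt : L ≠ ⊤) (hL : ∀ x ∈ A, L ≤ Φ (ball x ρ)) :
    volume A ≤ ENNReal.ofReal ((5 * ρ) ^ n) *
      volume (ball (0 : EuclideanSpace ℝ (Fin n)) 1) * (T / L) := by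
  obtain ⟨u, huA, hud, hcov⟩ := Vitali.exists_disjoint_subfamily_covering_enlargement_closedBall
    A (fun x => x) (fun _ => ρ) ρ (fun _ _ => le_rfl) 5 (by norm_num)
  have hud' : u.PairwiseDisjoint (fun x => ball x ρ) := hud.mono fun x => ball_subset_closedBall
  have hcount : u.Countable :=
    hud'.countable_of_isOpen (fun _ _ => isOpen_ball) (fun x _ => ⟨x, mem_ball_self hρ⟩)
  have hAu : A ⊆ ⋃ x ∈ u, closedBall x (5 * ρ) := by
    intro x hx
    obtain ⟨y, hy, hxy⟩ := hcov x hx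
    exact mem_iUnion₂.2 ⟨y, hy, hxy (mem_closedBall_self hρ.le)⟩
  have hsum : ∑' x : u, Φ (ball (x : EuclideanSpace ℝ (Fin n)) ρ) ≤ T := by
    refine ENNReal.summable.tsum_le_of_sum_le fun t => ?_
    have := hsup (t.map (Function.Embedding.subtype _)) ρ
      (fun x hx => by
        obtain ⟨y, -, rfl⟩ := Finset.mem_map.1 hx
        exact hA _ (huA y.2))
      (hud'.subset fun x hx => by
        obtain ⟨y, -, rfl⟩ := Finset.mem_map.1 (Finset.mem_coe.1 hx)
        exact y.2)
    simpa using this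
  have hvol : ∀ x : EuclideanSpace ℝ (Fin n), volume (closedBall x (5 * ρ)) =
      ENNReal.ofReal ((5 * ρ) ^ n) * volume (ball (0 : EuclideanSpace ℝ (Fin n)) 1) := fun x => by
    rw [Measure.addHaar_closedBall _ _ (by positivity), finrank_euclideanSpace_fin]
  calc volume A ≤ volume (⋃ x ∈ u, closedBall x (5 * ρ)) := measure_mono hAu
    _ ≤ ∑' x : u, volume (closedBall (x : EuclideanSpace ℝ (Fin n)) (5 * ρ)) :=
        measure_biUnion_le _ hcount _
    _ ≤ ∑' x : u, ENNReal.ofReal ((5 * ρ) ^ n) *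
          volume (ball (0 : EuclideanSpace ℝ (Fin n)) 1) *
          (Φ (ball (x : EuclideanSpace ℝ (Fin n)) ρ) / L) := by
        refine ENNReal.tsum_le_tsum fun x => ?_
        rw [hvol]
        refine le_mul_of_one_le_right' ?_
        rw [ENNReal.le_div_iff_mul_le (.inl hL0) (.inl hLt), one_mul]
        exact hL _ (huA x.2)
    _ = ENNReal.ofReal ((5 * ρ) ^ n) * volume (ball (0 : EuclideanSpace ℝ (Fin n)) 1) *
          ((∑' x : u, Φ (ball (x : EuclideanSpace ℝ (Fin n)) ρ)) / L) := by
        simp_rw [div_eq_mul_inv]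
        rw [ENNReal.tsum_mul_left, ENNReal.tsum_mul_right]
    _ ≤ _ := by gcongr

/-- A superadditive set function decays at some point at every dyadic scale, at any rate smaller
than the dimension. -/
lemma exists_dyadic_decay {T : ℝ≥0∞} (hT : T ≠ ⊤)
    (hsup : ∀ (t : Finset (EuclideanSpace ℝ (Fin n))) (ρ : ℝ), (∀ x ∈ t, ball x ρ ⊆ ball 0 2) →
      (t : Set (EuclideanSpace ℝ (Fin n))).PairwiseDisjoint (fun x => ball x ρ) →
      ∑ x ∈ t, Φ (ball x ρ) ≤ T)
    {η : ℝ} (hη : η < n) :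
    ∃ x : EuclideanSpace ℝ (Fin n), ∃ M : ℝ≥0∞, M ≠ ⊤ ∧
      ∀ k : ℕ, Φ (ball x ((1 / 2) ^ k)) ≤ M * ENNReal.ofReal (((1 / 2) ^ k) ^ η) := by
  set V := volume (ball (0 : EuclideanSpace ℝ (Fin n)) 1) with hV
  have hV0 : V ≠ 0 := (measure_ball_pos _ _ one_pos).ne'
  have hVt : V ≠ ⊤ := measure_ball_lt_top.ne
  set θ := ENNReal.ofReal ((1 / 2 : ℝ) ^ ((n : ℝ) - η)) with hθ
  have hθ1 : θ < 1 := by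
    rw [hθ, ENNReal.ofReal_lt_one]
    exact Real.rpow_lt_one (by norm_num) (by norm_num) (by linarith)
  set D := ENNReal.ofReal (5 ^ n) * T * (1 - θ)⁻¹ with hD
  have hDt : D ≠ ⊤ := ENNReal.mul_ne_top (ENNReal.mul_ne_top ENNReal.ofReal_ne_top hT)
    (ENNReal.inv_ne_top.2 (tsub_pos_of_lt hθ1).ne')
  set M := D + 1 with hM
  have hM0 : M ≠ 0 := by simp [hM]
  have hMt : M ≠ ⊤ := by simp [hM, hDt]
  by_contra! hcon
  set A : ℕ → Set (EuclideanSpace ℝ (Fin n)) := fun k =>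
    {x | x ∈ ball 0 1 ∧ M * ENNReal.ofReal (((1 / 2 : ℝ) ^ k) ^ η) ≤ Φ (ball x ((1 / 2) ^ k))}
    with hA
  have hAk : ∀ k, volume (A k) ≤ V * (ENNReal.ofReal (5 ^ n) * T / M) * θ ^ k := by
    intro k
    have hρ : (0 : ℝ) < (1 / 2) ^ k := by positivity
    have hρ1 : ((1 : ℝ) / 2) ^ k ≤ 1 := pow_le_one₀ (by norm_num) (by norm_num)
    have hρη : 0 < ((1 / 2 : ℝ) ^ k) ^ η := Real.rpow_pos_of_pos hρ _
    have hρη' : ENNReal.ofReal (((1 / 2 : ℝ) ^ k) ^ η) ≠ 0 := by simpa using hρη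
    refine (volume_setOf_lt_le hsup hρ (A := A k) (fun x hx => ball_subset_ball' ?_)
      (mul_ne_zero hM0 hρη') (ENNReal.mul_ne_top hMt ENNReal.ofReal_ne_top)
      (fun x hx => hx.2)).trans_eq ?_
    · have := mem_ball.1 hx.1
      linarith
    · have e : ((5 : ℝ) * (1 / 2) ^ k) ^ n =
          5 ^ n * (((1 / 2) ^ ((n : ℝ) - η)) ^ k * ((1 / 2) ^ k) ^ η) := by
        rw [mul_pow, ← Real.rpow_natCast ((1 / 2 : ℝ) ^ ((n : ℝ) - η)) k,
          ← Real.rpow_mul (by norm_num),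
          mul_comm _ (k : ℝ), Real.rpow_mul (by norm_num), Real.rpow_natCast, ← Real.rpow_add hρ,
          sub_add_cancel, Real.rpow_natCast]
      rw [e, ENNReal.ofReal_mul (by positivity), ENNReal.ofReal_mul (by positivity),
        ENNReal.ofReal_pow (p := (1 / 2 : ℝ) ^ ((n : ℝ) - η)) (by positivity), ← hθ, ← hV]
      simp only [div_eq_mul_inv]
      rw [ENNReal.mul_inv (.inl hM0) (.inl hMt)]
      set X := ENNReal.ofReal (((1 * 2⁻¹ : ℝ) ^ k) ^ η) with hX
      have hXX : X * X⁻¹ = 1 :=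
        ENNReal.mul_inv_cancel (by simpa [hX] using hρη') ENNReal.ofReal_ne_top
      calc _ = V * (ENNReal.ofReal (5 ^ n) * T * M⁻¹) * θ ^ k * (X * X⁻¹) := by ring
        _ = _ := by rw [hXX, mul_one]
  have hcover : ball (0 : EuclideanSpace ℝ (Fin n)) 1 ⊆ ⋃ k, A k := by
    intro x hx
    obtain ⟨k, hk⟩ := hcon x M hMt
    exact mem_iUnion.2 ⟨k, hx, hk.le⟩
  have hlt : V < V := by
    calc V ≤ volume (⋃ k, A k) := measure_mono hcover
      _ ≤ ∑' k, volume (A k) := measure_iUnion_le _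
      _ ≤ ∑' k, V * (ENNReal.ofReal (5 ^ n) * T / M) * θ ^ k := ENNReal.tsum_le_tsum hAk
      _ = V * (D / M) := by
          rw [ENNReal.tsum_mul_left, ENNReal.tsum_geometric, hD]
          simp only [div_eq_mul_inv]
          ring
      _ < V * 1 := by
          refine ENNReal.mul_lt_mul_right hV0 hVt ?_
          rw [ENNReal.div_lt_iff (.inl hM0) (.inl hMt), one_mul, hM]
          exact ENNReal.lt_add_right hDt one_ne_zero
      _ = V := mul_one V
  exact lt_irrefl _ hlt

lemma setLIntegral_Ioc_lt_top_of_dyadic_decay (hΦ : Monotone Φ) {γ η r : ℝ} (hr : 0 < r)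
    (hη : 0 ≤ η) (hγη : γ < η) {x : EuclideanSpace ℝ (Fin n)} {M : ℝ≥0∞} (hM : M ≠ ⊤)
    (h : ∀ k : ℕ, Φ (ball x ((1 / 2) ^ k)) ≤ M * ENNReal.ofReal (((1 / 2) ^ k) ^ η)) :
    ∫⁻ ρ in Ioc 0 1, (Φ (ball x ρ) / ENNReal.ofReal (ρ ^ γ)) ^ r / ENNReal.ofReal ρ < ⊤ := by
  set C := (M * ENNReal.ofReal (2 ^ η)) ^ r with hC
  have hCt : C ≠ ⊤ := ENNReal.rpow_ne_top_of_nonneg hr.le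
    (ENNReal.mul_ne_top hM ENNReal.ofReal_ne_top)
  have hint : ∫⁻ ρ in Ioc (0 : ℝ) 1, ENNReal.ofReal (ρ ^ ((η - γ) * r - 1)) < ⊤ := by
    have h1 : (-1 : ℝ) < (η - γ) * r - 1 := by nlinarith [mul_pos (sub_pos.2 hγη) hr]
    have h2 := (intervalIntegral.intervalIntegrable_rpow' (a := 0) (b := 1) h1).1
    exact h2.setLIntegral_lt_top
  refine lt_of_le_of_lt ?_ (ENNReal.mul_lt_top hCt.lt_top hint)
  rw [← lintegral_const_mul' _ _ hCt]
  refine setLIntegral_mono' measurableSet_Ioc fun ρ hρ => ?_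
  have hρ0 : 0 < ρ := hρ.1
  obtain ⟨k, hk1, hk2⟩ := exists_nat_pow_near_of_lt_one hρ.1 hρ.2
    (show (0 : ℝ) < 1 / 2 by norm_num) (by norm_num)
  have hΦρ : Φ (ball x ρ) ≤ M * ENNReal.ofReal (2 ^ η) * ENNReal.ofReal (ρ ^ η) := by
    refine (hΦ (ball_subset_ball hk2)).trans ((h k).trans ?_)
    rw [mul_assoc, ← ENNReal.ofReal_mul (by positivity), ← Real.mul_rpow (by norm_num) hρ0.le]
    gcongr
    rw [pow_succ] at hk1
    linarith
  have e : ρ ^ ((η - γ) * r - 1) = (ρ ^ η / ρ ^ γ) ^ r / ρ := by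
    rw [Real.rpow_sub hρ0, Real.rpow_mul hρ0.le, Real.rpow_sub hρ0, Real.rpow_one]
  have hργ : 0 < ρ ^ γ := Real.rpow_pos_of_pos hρ0 _
  rw [e, ENNReal.ofReal_div_of_pos hρ0, ← ENNReal.ofReal_rpow_of_nonneg (by positivity) hr.le,
    ENNReal.ofReal_div_of_pos hργ, ← mul_div_assoc, hC, ← ENNReal.mul_rpow_of_nonneg _ _ hr.le,
    ← mul_div_assoc]
  gcongr

end SetFunction

/-- `K_{α,p,q}σ(x) < ∞` for some `x` iff
`∫_a^∞ (κ(B(0,ρ))^{q(p−1)/(p−1−q)}/ρ^{n−αp})^{1/(p−1)} dρ/ρ < ∞` for some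
(equivalently, for all) `a > 0`. -/
theorem intK_finite_iff_tail_finite (n : ℕ) (hn : 1 ≤ n) (α p q : ℝ)
    (hp : 1 < p) (hq0 : 0 < q) (hqp : q < p - 1)
    (hα0 : 0 < α) (hαp : α < n / p)
    (σ : Measure (EuclideanSpace ℝ (Fin n))) (hσloc : IsLocallyFiniteMeasure σ) :
    ((∃ x : EuclideanSpace ℝ (Fin n), intK n α p q σ x < ⊤) ↔
      ∀ a : ℝ, 0 < a →
        (∫⁻ ρ in Set.Ioi a,
          (embC n α p q σ (Metric.ball (0 : EuclideanSpace ℝ (Fin n)) ρ) ^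
              (q * (p - 1) / (p - 1 - q)) /
            ENNReal.ofReal (ρ ^ ((n : ℝ) - α * p))) ^ (1 / (p - 1)) /
            ENNReal.ofReal ρ) < ⊤) ∧
    ((∃ x : EuclideanSpace ℝ (Fin n), intK n α p q σ x < ⊤) ↔
      ∃ a : ℝ, 0 < a ∧
        (∫⁻ ρ in Set.Ioi a,
          (embC n α p q σ (Metric.ball (0 : EuclideanSpace ℝ (Fin n)) ρ) ^
              (q * (p - 1) / (p - 1 - q)) /
            ENNReal.ofReal (ρ ^ ((n : ℝ) - α * p))) ^ (1 / (p - 1)) /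
            ENNReal.ofReal ρ) < ⊤) := by
  have hp1 : 0 < p - 1 := by linarith
  have hr : 0 < 1 / (p - 1) := one_div_pos.2 hp1
  have hs0 : 0 < q * (p - 1) / (p - 1 - q) := div_pos (mul_pos hq0 hp1) (by linarith)
  have hαpn : α * p < n := (lt_div_iff₀ (by linarith)).1 hαp
  have hαp0 : 0 < α * p := by positivity
  set Φ : Set (EuclideanSpace ℝ (Fin n)) → ℝ≥0∞ := fun E =>
    embC n α p q σ E ^ (q * (p - 1) / (p - 1 - q)) with hΦdef
  have hΦ : Monotone Φ := fun E F h => ENNReal.rpow_le_rpow (embC_mono hq0 h) hs0.le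
  have hforall : (∃ x, intK n α p q σ x < ⊤) → ∀ a : ℝ, 0 < a →
      ∫⁻ ρ in Ioi a, (Φ (ball 0 ρ) / ENNReal.ofReal (ρ ^ ((n : ℝ) - α * p))) ^ (1 / (p - 1)) /
        ENNReal.ofReal ρ < ⊤ := by
    rintro ⟨x, hx⟩ a ha
    exact setLIntegral_tail_lt_top hΦ hr ha hx
  have hexists : (∃ a : ℝ, 0 < a ∧
      ∫⁻ ρ in Ioi a, (Φ (ball 0 ρ) / ENNReal.ofReal (ρ ^ ((n : ℝ) - α * p))) ^ (1 / (p - 1)) /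
        ENNReal.ofReal ρ < ⊤) → ∃ x, intK n α p q σ x < ⊤ := by
    rintro ⟨a, -, ha⟩
    have hT : Φ (ball 0 2) ≠ ⊤ := ne_top_of_setLIntegral_tail_lt_top hΦ hr ha 2
    have hκ : embC n α p q σ (ball 0 2) ≠ ⊤ := fun h =>
      hT (by rw [hΦdef]; simp only [h, ENNReal.top_rpow_of_pos hs0])
    obtain ⟨x, M, hM, hx⟩ := exists_dyadic_decay (Φ := Φ) (η := n - α * p / 2) hT
      (fun t ρ hsub hd => sum_embC_rpow_le hp hq0 hqp hκ t (fun _ _ => measurableSet_ball) hd hsub)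
      (by linarith)
    refine ⟨x, ?_⟩
    rw [intK, ← Ioc_union_Ioi_eq_Ioi zero_le_one]
    refine (lintegral_union_le _ _ _).trans_lt (ENNReal.add_lt_top.2 ⟨?_, ?_⟩)
    · exact setLIntegral_Ioc_lt_top_of_dyadic_decay hΦ hr (by linarith) (by linarith) hM hx
    · exact setLIntegral_tail_lt_top hΦ hr one_pos ha
  exact ⟨⟨hforall, fun h => hexists ⟨1, one_pos, h 1 one_pos⟩⟩,
    ⟨fun h => ⟨1, one_pos, hforall h 1 one_pos⟩, hexists⟩⟩
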